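/- Let z₀ ∈ ∂U (so z₀ ∈ K ⊆ ℂ). Then K is locally connected at z₀ if and only if the following holds: for every δ > 0 there exists ε > 0 such that every point w ∈ U outside the open disk of radius δ about z₀ (i.e. every w ∈ U with either w = ∞ or |w − z₀| ≥ δ) can be joined to ∞ by a continuous curve γ contained in U that is disjoint from the closed disk {z ∈ ℂ : |z − z₀| ≤ ε}. -/

import Mathlib

open Filter Topology Metric Set OnePoint

noncomputable section

local notation "ℂ∞" => OnePoint ℂ

/-- A set `K` is locally connected (connected im kleinen) at a point `z`:
every neighborhood of `z` in `K` contains a connected neighborhood of `z` in `K`. -/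
def LocallyConnectedAt {X : Type*} [TopologicalSpace X] (K : Set X) (z : X) : Prop :=
  ∀ V ∈ 𝓝[K] z, ∃ N ∈ 𝓝[K] z, N ⊆ K ∩ V ∧ IsConnected N

/-- `φ : ℂ → ℂ∞` is holomorphic, as a map into the Riemann sphere, on `D`:
near every point of `D` it is either given by an analytic `ℂ`-valued function, or by the
reciprocal of one. -/
def HolomorphicIntoSphereOn (φ : ℂ → ℂ∞) (D : Set ℂ) : Prop :=
  ∀ z ∈ D,
    (∃ g : ℂ → ℂ, AnalyticAt ℂ g z ∧ ∀ᶠ w in 𝓝 z, φ w = ((g w : ℂ) : ℂ∞)) ∨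
    (∃ g : ℂ → ℂ, AnalyticAt ℂ g z ∧
      ∀ᶠ w in 𝓝 z, φ w = if g w = 0 then (∞ : ℂ∞) else (((g w)⁻¹ : ℂ) : ℂ∞))

/-- The impression of the prime end `ζ ∈ ∂𝔻` (cluster set of `φ` at `ζ`). -/
def impression (φ : ℂ → ℂ∞) (ζ : ℂ) : Set ℂ∞ :=
  {z | ∃ w : ℕ → ℂ, (∀ j, w j ∈ ball (0 : ℂ) 1) ∧ Tendsto w atTop (𝓝 ζ) ∧
    Tendsto (fun j => φ (w j)) atTop (𝓝 z)}

/-- The set of principal points of the prime end `ζ` (radial cluster set of `φ` at `ζ`). -/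
def principalPoints (φ : ℂ → ℂ∞) (ζ : ℂ) : Set ℂ∞ :=
  {z | ∃ t : ℕ → ℝ, (∀ j, t j ∈ Ico (0 : ℝ) 1) ∧ Tendsto t atTop (𝓝 1) ∧
    Tendsto (fun j => φ ((t j : ℂ) * ζ)) atTop (𝓝 z)}

/-- The accumulation set of a curve `Γ : [0,∞) → ℂ∞`: all limits of sequences `Γ (t j)`
with `t j → ∞`. -/
def accSet (Γ : ℝ → ℂ∞) : Set ℂ∞ :=
  {z | ∃ t : ℕ → ℝ, Tendsto t atTop atTop ∧ Tendsto (fun j => Γ (t j)) atTop (𝓝 z)}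

/-- `Γ` is a (continuous) curve `[0,∞) → U`. -/
def IsCurveIn (U : Set ℂ∞) (Γ : ℝ → ℂ∞) : Prop :=
  ContinuousOn Γ (Ici 0) ∧ MapsTo Γ (Ici 0) U

/-- The curve `Γ : [0,∞) → U` converges to the prime end `ζ`: `φ⁻¹(Γ(t)) = ψ(Γ(t)) → ζ`. -/
def ConvergesToPrimeEnd (U : Set ℂ∞) (ψ : ℂ∞ → ℂ) (Γ : ℝ → ℂ∞) (ζ : ℂ) : Prop :=
  IsCurveIn U Γ ∧ Tendsto (fun t => ψ (Γ t)) atTop (𝓝 ζ)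

/-- `Γ` converges to the prime end `ζ` from the left. -/
def ConvergesFromLeft (U : Set ℂ∞) (ψ : ℂ∞ → ℂ) (Γ : ℝ → ℂ∞) (ζ : ℂ) : Prop :=
  ConvergesToPrimeEnd U ψ Γ ζ ∧ ∀ᶠ t in atTop, 0 ≤ (ψ (Γ t) / ζ).im

/-- `Γ` converges to the prime end `ζ` from the right. -/
def ConvergesFromRight (U : Set ℂ∞) (ψ : ℂ∞ → ℂ) (Γ : ℝ → ℂ∞) (ζ : ℂ) : Prop :=
  ConvergesToPrimeEnd U ψ Γ ζ ∧ ∀ᶠ t in atTop, (ψ (Γ t) / ζ).im ≤ 0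

/-- The left wing `I⁺(ζ)` of the prime end `ζ`. -/
def leftWing (U : Set ℂ∞) (ψ : ℂ∞ → ℂ) (ζ : ℂ) : Set ℂ∞ :=
  {z | ∃ Γ : ℝ → ℂ∞, ConvergesFromLeft U ψ Γ ζ ∧ z ∈ accSet Γ}

/-- The right wing `I⁻(ζ)` of the prime end `ζ`. -/
def rightWing (U : Set ℂ∞) (ψ : ℂ∞ → ℂ) (ζ : ℂ) : Set ℂ∞ :=
  {z | ∃ Γ : ℝ → ℂ∞, ConvergesFromRight U ψ Γ ζ ∧ z ∈ accSet Γ}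

/-- `z` has priority over `w` in the left wing of `ζ`. -/
def PriorityLeft (U : Set ℂ∞) (ψ : ℂ∞ → ℂ) (ζ : ℂ) (z w : ℂ∞) : Prop :=
  ∀ Γ : ℝ → ℂ∞, ConvergesFromLeft U ψ Γ ζ → w ∈ accSet Γ → z ∈ accSet Γ

/-- `z` has priority over `w` in the right wing of `ζ`. -/
def PriorityRight (U : Set ℂ∞) (ψ : ℂ∞ → ℂ) (ζ : ℂ) (z w : ℂ∞) : Prop :=
  ∀ Γ : ℝ → ℂ∞, ConvergesFromRight U ψ Γ ζ → w ∈ accSet Γ → z ∈ accSet Γ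

/-- The sequence `w` accumulates at `z` (some subsequence converges to `z`). -/
def SeqAccumAt (w : ℕ → ℂ∞) (z : ℂ∞) : Prop :=
  ∃ n : ℕ → ℕ, StrictMono n ∧ Tendsto (fun j => w (n j)) atTop (𝓝 z)

/-- `z₀` is strongly minimal in the prime end `ζ`: every sequence in `U` converging to the
prime end `ζ` and not accumulating at `z₀` lies on a curve converging to `ζ` whose
accumulation set misses `z₀`. -/
def StronglyMinimal (U : Set ℂ∞) (ψ : ℂ∞ → ℂ) (ζ : ℂ) (z₀ : ℂ∞) : Prop :=
  ∀ w : ℕ → ℂ∞, (∀ j, w j ∈ U) → Tendsto (fun j => ψ (w j)) atTop (𝓝 ζ) →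
    ¬ SeqAccumAt w z₀ →
    ∃ Γ : ℝ → ℂ∞, ConvergesToPrimeEnd U ψ Γ ζ ∧ (∀ j, ∃ t, 0 ≤ t ∧ Γ t = w j) ∧
      z₀ ∉ accSet Γ



instance lpcSphere : LocallyPathConnectedSpace ℂ∞ := by
  have h : Module.finrank ℝ ℂ + 1 = Fintype.card (Fin 3) := by simp [Complex.finrank_real_complex]
  let e := onePointEquivSphereOfFinrankEq (ι := Fin 3) (V := ℂ) h
  have : Fact (Module.finrank ℝ (EuclideanSpace ℝ (Fin 3)) = 2 + 1) := ⟨by simp⟩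
  have := ChartedSpace.locallyPathConnectedSpace (EuclideanSpace ℝ (Fin 2))
    (sphere (0 : EuclideanSpace ℝ (Fin 3)) 1)
  exact e.isOpenEmbedding.locallyPathConnectedSpace

theorem exp_lift_unique {A : Type*} [TopologicalSpace A] {s : Set A} (hs : IsPreconnected s)
    {g₁ g₂ : A → ℂ} (h₁ : ContinuousOn g₁ s) (h₂ : ContinuousOn g₂ s)
    (he : ∀ a ∈ s, Complex.exp (g₁ a) = Complex.exp (g₂ a)) {a : A} (ha : a ∈ s)
    (h : g₁ a = g₂ a) : ∀ b ∈ s, g₁ b = g₂ b := fun b hb =>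
  Complex.isCoveringMap_exp.eqOn_of_comp_eqOn hs h₁ h₂
    (fun x hx => Subtype.ext (he x hx)) ha h hb

theorem no_ext (G : ℂ → ℂ) (hG : Continuous G) (h0 : ∀ z, G z ≠ 0) (a : ℂ) (R : ℝ)
    (hR : ∀ z, R ≤ dist z a → G z = z - a) : False := by
  obtain ⟨g, hg, hge⟩ := Complex.exists_continuousOn_eqOn_exp_comp (U := (univ : Set ℂ))
    (by
      have := convex_univ.contractibleSpace (univ_nonempty : (univ : Set ℂ).Nonempty)
      exact (inferInstance : SimplyConnectedSpace (univ : Set ℂ))) isOpen_univ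
    hG.continuousOn (by rintro ⟨z, -, hz⟩; exact h0 z hz)
  rw [continuousOn_univ] at hg
  set r : ℝ := max R 1 with hr
  have hr0 : 0 < r := lt_of_lt_of_le one_pos (le_max_right _ _)
  have key : ∀ θ : ℝ, Complex.exp (g (a + r * Complex.exp (θ * Complex.I)))
      = r * Complex.exp (θ * Complex.I) := by
    intro θ
    have := hge (mem_univ (a + r * Complex.exp (θ * Complex.I)))
    simp only [Function.comp] at this
    rw [this, hR]
    · ring
    · rw [dist_eq_norm, add_sub_cancel_left, norm_mul, Complex.norm_exp_ofReal_mul_I, mul_one,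
        Complex.norm_real, Real.norm_of_nonneg hr0.le]
      exact le_max_left _ _
  have := exp_lift_unique (A := ℝ) (s := univ) isPreconnected_univ
    (g₁ := fun θ => g (a + r * Complex.exp (θ * Complex.I)))
    (g₂ := fun θ => g (a + r) + θ * Complex.I)
    (Continuous.continuousOn (by fun_prop)) (Continuous.continuousOn (by fun_prop))
    (by
      intro θ _
      have h := key 0
      simp only [Complex.ofReal_zero, zero_mul, Complex.exp_zero, mul_one] at h
      rw [key, Complex.exp_add, h]) (a := 0) (mem_univ _) (by simp) (2 * Real.pi) (mem_univ _)
  simp [Complex.exp_two_pi_mul_I] at this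

def HasLog (X : Set ℂ) (w : ℂ) : Prop :=
  ∃ g : ℂ → ℂ, ContinuousOn g X ∧ ∀ z ∈ X, Complex.exp (g z) = z - w

theorem HasLog.move {X : Set ℂ} {w w' : ℂ} (h : HasLog X w)
    (hd : ∀ z ∈ X, ‖w - w'‖ < ‖z - w‖) : HasLog X w' := by
  obtain ⟨g, hg, hge⟩ := h
  have hne : ∀ z ∈ X, z - w ≠ 0 := fun z hz h0 => by
    have := hd z hz
    rw [h0, norm_zero] at this
    exact absurd this (not_lt.2 (norm_nonneg _))
  have hs : ∀ z ∈ X, 1 + (w - w') / (z - w) ∈ Complex.slitPlane := fun z hz => by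
    apply Complex.mem_slitPlane_of_norm_lt_one
    rw [norm_div, div_lt_one (norm_pos_iff.2 (hne z hz))]
    exact hd z hz
  refine ⟨fun z => g z + Complex.log (1 + (w - w') / (z - w)), ?_, ?_⟩
  · refine hg.add (ContinuousOn.clog ?_ hs)
    exact continuousOn_const.add (continuousOn_const.div (by fun_prop) hne)
  · intro z hz
    rw [Complex.exp_add, hge z hz, Complex.exp_log (Complex.slitPlane_ne_zero (hs z hz))]
    field_simp [hne z hz]
    ring

theorem HasLog.far {X : Set ℂ} {w c : ℂ} (hd : ∀ z ∈ X, ‖z - c‖ < ‖w - c‖) : HasLog X w := by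
  by_cases hw : w - c = 0
  · exact ⟨fun _ => 0, continuousOn_const, fun z hz => by
      have := hd z hz
      rw [hw, norm_zero] at this
      exact absurd this (not_lt.2 (norm_nonneg _))⟩
  have hs : ∀ z ∈ X, 1 + (-(z - c) / (w - c)) ∈ Complex.slitPlane := fun z hz => by
    apply Complex.mem_slitPlane_of_norm_lt_one
    rw [norm_div, norm_neg, div_lt_one (norm_pos_iff.2 hw)]
    exact hd z hz
  refine ⟨fun z => Complex.log (-(w - c)) + Complex.log (1 + (-(z - c) / (w - c))), ?_, ?_⟩
  · refine continuousOn_const.add (ContinuousOn.clog ?_ hs)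
    fun_prop
  · intro z hz
    rw [Complex.exp_add, Complex.exp_log (neg_ne_zero.2 hw),
      Complex.exp_log (Complex.slitPlane_ne_zero (hs z hz))]
    field_simp
    ring

theorem hasLog_of_connected (U : Set ℂ∞) (hUo : IsOpen U) (hU : IsPreconnected U) (hi : ∞ ∈ U)
    (X : Set ℂ) (hX : IsCompact X) (hXU : ∀ z ∈ X, (z : ℂ∞) ∉ U) (w : ℂ) (hw : (w : ℂ∞) ∈ U) :
    HasLog X w := by
  set S : Set ℂ∞ := {p | p ∈ U ∧ ∀ w : ℂ, p = w → HasLog X w} with hS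
  -- local constancy at finite points
  have loc : ∀ w : ℂ, (w : ℂ∞) ∈ U → ∀ᶠ w' : ℂ in 𝓝 w, (w' : ℂ∞) ∈ U ∧ (HasLog X w ↔ HasLog X w') := by
    intro w hw
    have hwX : w ∉ X := fun h => hXU w h hw
    obtain ⟨r, hr, hrX⟩ := Metric.isOpen_iff.1 hX.isClosed.isOpen_compl w hwX
    have h1 : ∀ᶠ w' : ℂ in 𝓝 w, (w' : ℂ∞) ∈ U :=
      (continuous_coe.tendsto w) (hUo.mem_nhds hw)
    filter_upwards [h1, Metric.ball_mem_nhds w (half_pos hr)] with w' h1 h2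
    have hz : ∀ z ∈ X, r ≤ ‖z - w‖ := fun z hz => by
      by_contra hlt
      exact hrX (by simpa [dist_eq_norm] using hlt) hz
    have h2' : ‖w' - w‖ < r / 2 := by simpa [dist_eq_norm] using h2
    refine ⟨h1, fun h => h.move fun z hzX => ?_, fun h => h.move fun z hzX => ?_⟩
    · rw [norm_sub_rev]; linarith [hz z hzX]
    · have := norm_sub_le_norm_sub_add_norm_sub z w' w
      linarith [hz z hzX]
  have hSo : IsOpen S := by
    rw [isOpen_iff_mem_nhds]
    intro p hp
    induction p using OnePoint.rec with
    | infty =>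
      obtain ⟨R, hR⟩ := hX.isBounded.subset_closedBall 0
      refine inter_mem (hUo.mem_nhds hi) (?_ : {p : ℂ∞ | ∀ w : ℂ, p = w → HasLog X w} ∈ 𝓝 ∞)
      rw [nhds_infty_eq]
      refine ⟨?_, ?_⟩
      · rw [mem_map, coclosedCompact_eq_cocompact, ← Metric.cobounded_eq_cocompact]
        have := Bornology.isBounded_def.1 (Metric.isBounded_closedBall (x := (0:ℂ)) (r := R))
        filter_upwards [this] with x hx w hw
        rw [OnePoint.coe_eq_coe] at hw
        subst hw
        refine HasLog.far (c := 0) fun z hz => ?_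
        have h1 := hR hz
        simp at h1 hx
        simp; linarith
      · intro w hw
        exact absurd hw (OnePoint.infty_ne_coe w)
    | coe w =>
      rw [nhds_coe_eq, mem_map]
      filter_upwards [loc w hp.1] with w' h
      exact ⟨h.1, fun v hv => by
        rw [OnePoint.coe_eq_coe] at hv; subst hv; exact h.2.1 (hp.2 w rfl)⟩
  have hsub : U ⊆ S := by
    refine hU.subset_of_closure_inter_subset hSo ⟨∞, hi, hi, fun w hw => absurd hw (OnePoint.infty_ne_coe w)⟩ ?_
    rintro p ⟨hpc, hpU⟩
    refine ⟨hpU, fun w hw => ?_⟩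
    subst hw
    have h1 := loc w hpU
    rw [mem_closure_iff_frequently, nhds_coe_eq, frequently_map] at hpc
    obtain ⟨w', h2, h3⟩ := (hpc.and_eventually h1).exists
    exact h3.2.2 (h2.2 w' rfl)
  exact (hsub hw).2 w rfl

theorem joined_of_hasLog (X : Set ℂ) (hX : IsCompact X) (w : ℂ) (hw : w ∉ X) (h : HasLog X w) :
    JoinedIn ((fun c : ℂ => (c : ℂ∞)) '' X)ᶜ (w : ℂ∞) ∞ := by
  set O : Set ℂ∞ := ((fun c : ℂ => (c : ℂ∞)) '' X)ᶜ with hO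
  have hOo : IsOpen O := isOpen_compl_image_coe.2 ⟨hX.isClosed, hX⟩
  have hwO : (w : ℂ∞) ∈ O := by simpa [hO] using hw
  have hiO : ∞ ∈ O := by simp [hO]
  set W := connectedComponentIn O (w : ℂ∞) with hW
  have hWo : IsOpen W := hOo.connectedComponentIn
  have hWc : IsConnected W := isConnected_connectedComponentIn_iff.2 hwO
  have hwW : (w : ℂ∞) ∈ W := mem_connectedComponentIn hwO
  by_cases hi : ∞ ∈ W
  · exact ((hWo.isConnected_iff_isPathConnected.1 hWc).joinedIn _ hwW _ hi).mono
      (connectedComponentIn_subset _ _)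
  exfalso
  -- closure of W meets O only in W
  have hcl : closure W ∩ O ⊆ W := by
    rintro p ⟨hp, hpO⟩
    have h1 : IsPreconnected (insert p W) :=
      hWc.isPreconnected.subset_closure (subset_insert _ _)
        (insert_subset hp subset_closure)
    exact h1.subset_connectedComponentIn (mem_insert_of_mem _ hwW)
      (insert_subset hpO (connectedComponentIn_subset _ _)) (mem_insert _ _)
  set W' : Set ℂ := (fun c : ℂ => (c : ℂ∞)) ⁻¹' W with hW'
  have hfr : ∀ z ∈ frontier W', z ∈ X := by
    intro z hz
    by_contra hzX
    have h1 : (z : ℂ∞) ∈ closure W := by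
      have := continuous_coe.closure_preimage_subset W hz.1
      exact this
    have h2 : (z : ℂ∞) ∈ W := hcl ⟨h1, by simpa [hO] using hzX⟩
    apply hz.2
    rw [(hWo.preimage continuous_coe).interior_eq]
    exact h2
  have hbd : ∃ R, ∀ z, R ≤ dist z w → z ∉ W' := by
    have h1 : (closure W)ᶜ ∈ 𝓝 (∞ : ℂ∞) :=
      isClosed_closure.isOpen_compl.mem_nhds fun h => hi (hcl ⟨h, hiO⟩)
    rw [nhds_infty_eq] at h1
    have h2 := h1.1
    rw [mem_map, coclosedCompact_eq_cocompact, ← Metric.cobounded_eq_cocompact,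
      ← Metric.comap_dist_left_atTop w] at h2
    obtain ⟨t, ht, hts⟩ := h2
    obtain ⟨R, hR⟩ := mem_atTop_sets.1 ht
    refine ⟨R, fun z hz hzW => ?_⟩
    exact hts (hR _ (by simpa [dist_comm] using hz) : z ∈ _) (subset_closure hzW)
  obtain ⟨R, hR⟩ := hbd
  obtain ⟨g, hg, hge⟩ := h
  obtain ⟨g', hg'⟩ := ContinuousMap.exists_restrict_eq hX.isClosed
    ⟨X.domRestrict g, continuousOn_iff_continuous_domRestrict.1 hg⟩
  have hg'' : ∀ z ∈ X, g' z = g z := fun z hz => by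
    have := congrArg (fun f => f ⟨z, hz⟩) hg'
    simpa using this
  classical
  refine no_ext (fun z => if z ∈ W' then Complex.exp (g' z) else z - w) ?_ ?_ w R ?_
  · refine Continuous.if ?_ (by fun_prop) (by fun_prop)
    intro z hz
    have := hfr z hz
    rw [hg'' z this, hge z this]
  · intro z
    split_ifs with hz
    · exact Complex.exp_ne_zero _
    · intro h0
      rw [sub_eq_zero] at h0
      subst h0
      exact hz hwW
  · intro z hz
    simp [hR z hz]

theorem HasLog.union {A B M : Set ℂ} {w : ℂ} (hA : HasLog A w) (hB : HasLog B w)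
    (hAc : IsClosed A) (hBc : IsClosed B) (hM : IsPreconnected M) (hMne : M.Nonempty)
    (hAB : A ∩ B = M) : HasLog (A ∪ B) w := by
  classical
  obtain ⟨g, hg, hge⟩ := hA
  obtain ⟨k, hk, hke⟩ := hB
  obtain ⟨m, hm⟩ := hMne
  have hmA : m ∈ A := (hAB ▸ hm : m ∈ A ∩ B).1
  have hmB : m ∈ B := (hAB ▸ hm : m ∈ A ∩ B).2
  have hMA : M ⊆ A := hAB ▸ inter_subset_left
  have hMB : M ⊆ B := hAB ▸ inter_subset_right
  set c := g m - k m with hc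
  have hce : Complex.exp c = 1 := by
    rw [hc, Complex.exp_sub, hge m hmA, hke m hmB, div_self]
    rw [← hge m hmA]; exact Complex.exp_ne_zero _
  have hkc : ∀ z ∈ B, Complex.exp (k z + c) = z - w := fun z hz => by
    rw [Complex.exp_add, hce, mul_one, hke z hz]
  have heq : ∀ z ∈ M, g z = k z + c :=
    exp_lift_unique hM (hg.mono hMA) ((hk.mono hMB).add continuousOn_const)
      (fun z hz => by rw [hge z (hMA hz), hkc z (hMB hz)]) hm (by rw [hc]; ring)
  refine ⟨fun z => if z ∈ A then g z else k z + c, ?_, ?_⟩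
  · refine ContinuousOn.union_of_isClosed ?_ ?_ hAc hBc
    · exact hg.congr fun z hz => by simp [hz]
    · refine (hk.add (continuousOn_const (c := c))).congr fun z hz => ?_
      by_cases hzA : z ∈ A
      · simp only [hzA, if_true]
        exact heq z (hAB ▸ ⟨hzA, hz⟩)
      · simp [hzA]
  · intro z hz
    by_cases hzA : z ∈ A
    · simp [hzA, hge z hzA]
    · simp only [hzA, if_false]
      exact hkc z (hz.resolve_left hzA)

theorem forward (U : Set ℂ∞) (hUopen : IsOpen U) (hUconn : IsConnected U) (hinfty : ∞ ∈ U)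
    (z₀ : ℂ) (hz₀ : (z₀ : ℂ∞) ∉ U)
    (hL : LocallyConnectedAt Uᶜ (z₀ : ℂ∞)) (δ : ℝ) (hδ : 0 < δ) :
    ∃ ε > (0 : ℝ), ∀ w ∈ U,
        (w = ∞ ∨ ∀ x : ℂ, w = (x : ℂ∞) → δ ≤ dist x z₀) →
        ∃ γ : ℝ → ℂ∞, ContinuousOn γ (Icc 0 1) ∧ γ 0 = w ∧ γ 1 = ∞ ∧
          MapsTo γ (Icc 0 1) (U \ ((fun c : ℂ => (c : ℂ∞)) '' closedBall z₀ ε)) := by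
  set K : Set ℂ := (fun c : ℂ => (c : ℂ∞)) ⁻¹' Uᶜ with hK
  have hKU : (fun c : ℂ => (c : ℂ∞)) '' K = Uᶜ := by
    refine image_preimage_eq_of_subset fun p hp => ?_
    have : p ≠ ∞ := fun h => hp (h ▸ hinfty)
    exact ne_infty_iff_exists.1 this
  have hKc : IsCompact K := by
    have := hUopen.isClosed_compl
    rw [← hKU] at this
    exact (isClosed_image_coe.1 this).2
  obtain ⟨N, hN, hNs, hNc⟩ := hL ((fun c : ℂ => (c : ℂ∞)) '' closedBall z₀ (δ / 2)) (by
    refine mem_nhdsWithin_of_mem_nhds ?_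
    rw [nhds_coe_eq]
    exact image_mem_map (closedBall_mem_nhds _ (half_pos hδ)))
  set N' : Set ℂ := (fun c : ℂ => (c : ℂ∞)) ⁻¹' N with hN'
  have hN'N : (fun c : ℂ => (c : ℂ∞)) '' N' = N := by
    refine image_preimage_eq_of_subset fun p hp => ?_
    obtain ⟨x, -, hx⟩ := (hNs hp).2
    exact ⟨x, hx⟩
  have hN'c : IsPreconnected N' := by
    rw [← isOpenEmbedding_coe.isInducing.isPreconnected_image]
    exact hN'N ▸ hNc.isPreconnected
  have hN'K : N' ⊆ K := fun z hz => (hNs hz).1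
  have hN'b : N' ⊆ closedBall z₀ (δ / 2) := fun z hz => by
    obtain ⟨x, hx, hxz⟩ := (hNs hz).2
    rwa [← OnePoint.coe_injective hxz]
  rw [nhdsWithin_coe, mem_map] at hN
  obtain ⟨r, hr, hrN⟩ := Metric.mem_nhdsWithin_iff.1 hN
  set ε := min (r / 2) (δ / 2) with hε
  have hεpos : 0 < ε := lt_min (half_pos hr) (half_pos hδ)
  have hεN : closedBall z₀ ε ∩ K ⊆ N' := fun z hz => hrN
    ⟨closedBall_subset_ball (lt_of_le_of_lt (min_le_left _ _) (half_lt_self hr)) hz.1, hz.2⟩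
  refine ⟨ε, hεpos, fun w hw hwd => ?_⟩
  set M := closure N' with hM
  have hMK : M ⊆ K := closure_minimal hN'K hKc.isClosed
  have hMb : M ⊆ closedBall z₀ (δ / 2) := closure_minimal hN'b isClosed_closedBall
  have hz₀M : z₀ ∈ M := subset_closure (hεN ⟨mem_closedBall_self hεpos.le, hz₀⟩)
  have hBb : M ∪ closedBall z₀ ε ⊆ closedBall z₀ (δ / 2) :=
    union_subset hMb (closedBall_subset_closedBall (min_le_right _ _))
  have hMc : IsCompact M := hKc.of_isClosed_subset isClosed_closure hMK
  have hBc : IsCompact (M ∪ closedBall z₀ ε) := hMc.union (isCompact_closedBall _ _)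
  have hJ : JoinedIn (U \ ((fun c : ℂ => (c : ℂ∞)) '' closedBall z₀ ε)) w ∞ := by
    induction w using OnePoint.rec with
    | infty => exact JoinedIn.refl ⟨hw, by simp⟩
    | coe w =>
      have hwd' : δ ≤ dist w z₀ := by
        rcases hwd with h | h
        · exact absurd h (OnePoint.coe_ne_infty w)
        · exact h w rfl
      have h1 : HasLog K w := hasLog_of_connected U hUopen hUconn.isPreconnected hinfty K hKc
        (fun z hz => hz) w hw
      have h2 : HasLog (M ∪ closedBall z₀ ε) w := HasLog.far (c := z₀) fun z hz => by
        have := hBb hz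
        rw [mem_closedBall, dist_eq_norm] at this
        rw [dist_eq_norm] at hwd'
        linarith
      have h3 := h1.union h2 hKc.isClosed hBc.isClosed hN'c.closure ⟨z₀, hz₀M⟩ (by
        apply Subset.antisymm
        · rintro z ⟨hz, hz' | hz'⟩
          · exact hz'
          · exact subset_closure (hεN ⟨hz', hz⟩)
        · exact fun z hz => ⟨hMK hz, Or.inl hz⟩)
      have h4 := joined_of_hasLog _ (hKc.union hBc) w (by
        rintro (h | h)
        · exact h hw
        · have := hBb h
          rw [mem_closedBall] at this
          linarith) h3
      refine h4.mono fun p hp => ⟨?_, ?_⟩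
      · by_contra hpU
        have : p ∈ Uᶜ := hpU
        rw [← hKU] at this
        exact hp (image_mono subset_union_left this)
      · intro h
        exact hp (image_mono (subset_union_right.trans subset_union_right) h)
  obtain ⟨γ, hγ⟩ := hJ
  refine ⟨γ.extend, γ.continuous_extend.continuousOn, γ.extend_zero, γ.extend_one, ?_⟩
  intro t ht
  rw [γ.extend_apply ht]
  exact hγ _

def sphereRatio (a b : ℂ) (p : ℂ∞) : ℂ := p.elim 1 fun z => (z - a) / (z - b)

theorem sphereRatio_continuousAt (a b : ℂ) (p : ℂ∞) (hp : p ≠ b) :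
    ContinuousAt (sphereRatio a b) p := by
  induction p using OnePoint.rec with
  | infty =>
    rw [continuousAt_infty', coclosedCompact_eq_cocompact, ← Metric.cobounded_eq_cocompact]
    have h1 : Tendsto (fun z : ℂ => z - b) (Bornology.cobounded ℂ) (Bornology.cobounded ℂ) := by
      simpa [sub_eq_add_neg] using Filter.tendsto_add_const_cobounded (-b)
    have h2 : Tendsto (fun z : ℂ => 1 + (b - a) * (z - b)⁻¹) (Bornology.cobounded ℂ)
        (𝓝 (1 + (b - a) * 0)) :=
      tendsto_const_nhds.add ((tendsto_inv₀_cobounded.comp h1).const_mul _)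
    rw [mul_zero, add_zero] at h2
    refine h2.congr' ?_
    have h3 : ({b} : Set ℂ)ᶜ ∈ Bornology.cobounded ℂ :=
      Bornology.isBounded_def.1 Bornology.isBounded_singleton
    filter_upwards [h3] with z hz
    have : z - b ≠ 0 := sub_ne_zero.2 hz
    simp only [sphereRatio, Function.comp, OnePoint.elim_some]
    field_simp
    ring
  | coe z =>
    rw [continuousAt_coe]
    have : z - b ≠ 0 := sub_ne_zero.2 fun h => hp (by rw [h])
    change ContinuousAt (fun z => (z - a) / (z - b)) z
    exact ContinuousAt.div (by fun_prop) (by fun_prop) this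

theorem sphereRatio_slit (a b : ℂ) (C : Set ℂ) (hC : Convex ℝ C) (ha : a ∈ C) (hb : b ∈ C)
    (p : ℂ∞) (hp : p ∉ (fun c : ℂ => (c : ℂ∞)) '' C) : sphereRatio a b p ∈ Complex.slitPlane := by
  induction p using OnePoint.rec with
  | infty => simp [sphereRatio]
  | coe z =>
    have hz : z ∉ C := fun h => hp ⟨z, h, rfl⟩
    have hzb : z - b ≠ 0 := sub_ne_zero.2 fun h => hz (h ▸ hb)
    change (z - a) / (z - b) ∈ _
    rw [Complex.mem_slitPlane_iff_not_le_zero]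
    intro hle
    obtain ⟨t, ht, hte⟩ : ∃ t : ℝ, 0 ≤ t ∧ (z - a) / (z - b) = -(t : ℂ) := by
      refine ⟨-((z - a) / (z - b)).re, ?_, ?_⟩
      · have := (Complex.le_def.1 hle).1
        simpa using this
      · have := (Complex.le_def.1 hle).2
        apply Complex.ext <;> simp at this ⊢
        exact this
    rw [div_eq_iff hzb] at hte
    apply hz
    have ht1 : (1 + t : ℝ) ≠ 0 := by positivity
    have ht1' : (1 + t : ℂ) ≠ 0 := by exact_mod_cast ht1
    have : z = (1 / (1 + t) : ℝ) • a + (t / (1 + t) : ℝ) • b := by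
      simp only [Complex.real_smul]
      push_cast
      field_simp
      linear_combination hte
    rw [this]
    exact hC ha hb (by positivity) (by positivity) (by field_simp)

theorem split_contra (Kd A B : Set ℂ) (hA : IsCompact A) (hB : IsCompact B) (hAB : Disjoint A B)
    (hK : Kd = A ∪ B) (a b : ℂ) (ha : a ∈ A) (hb : b ∈ B) (ℓ : ℂ → ℂ)
    (hℓ : ContinuousOn ℓ Kdᶜ) (hℓe : ∀ z ∉ Kd, Complex.exp (ℓ z) = (z - a) / (z - b)) : False := by
  classical
  obtain ⟨R, hR⟩ := hA.isBounded.subset_ball a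
  have hfar : IsClosed {z : ℂ | R ≤ dist z a} := isClosed_le continuous_const (by fun_prop)
  obtain ⟨f, hf0, hf1, hf⟩ := exists_continuous_zero_one_of_isClosed (hB.isClosed.union hfar)
    hA.isClosed (by
      rw [disjoint_union_left]
      refine ⟨hAB.symm, ?_⟩
      rw [Set.disjoint_left]
      intro z hz hzA
      exact absurd (mem_ball.1 (hR hzA)) (not_lt.2 hz))
  set χ : ℂ → ℝ := fun z => max 0 (min 1 (3 * f z - 1)) with hχ
  have hχc : Continuous χ := by fun_prop
  have hχ1 : ∀ z, 2 / 3 < f z → χ z = 1 := fun z hz => by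
    simp only [hχ]
    rw [min_eq_left (by linarith)]; simp
  have hχ0 : ∀ z, f z < 1 / 3 → χ z = 0 := fun z hz => by
    simp only [hχ]
    exact max_eq_left ((min_le_right _ _).trans (by linarith))
  have hbA : ∀ z ∈ A, z ≠ b := fun z hz h => Set.disjoint_left.1 hAB hz (h ▸ hb)
  have haB : ∀ z ∈ B, z ≠ a := fun z hz h => Set.disjoint_left.1 hAB ha (h ▸ hz)
  have haK : ∀ z ∉ Kd, z ≠ a := fun z hz h => hz (hK ▸ Or.inl (h ▸ ha))
  have hbK : ∀ z ∉ Kd, z ≠ b := fun z hz h => hz (hK ▸ Or.inr (h ▸ hb))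
  have hKc : IsClosed Kd := hK ▸ (hA.union hB).isClosed
  set G : ℂ → ℂ := fun z => if z ∈ Kd then (if z ∈ A then z - b else z - a)
    else (z - a) * Complex.exp (-(χ z * ℓ z)) with hG
  refine no_ext G ?_ ?_ a R ?_
  · rw [continuous_iff_continuousAt]
    intro z
    by_cases hz : z ∈ Kd
    · rcases (hK ▸ hz : z ∈ A ∪ B) with hzA | hzB
      · have h1 : ∀ᶠ y in 𝓝 z, 2 / 3 < f y := by
          have : 2 / 3 < f z := by rw [hf1 hzA]; norm_num
          exact f.continuous.continuousAt.eventually (lt_mem_nhds this)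
        have h2 : G =ᶠ[𝓝 z] fun y => y - b := by
          filter_upwards [h1] with y hy
          simp only [hG]
          split_ifs with h3 h4
          · rfl
          · have : y ∈ B := (hK ▸ h3 : y ∈ A ∪ B).resolve_left h4
            rw [hf0 (Or.inl this)] at hy
            norm_num at hy
          · have e1 := sub_ne_zero.2 (haK y h3)
            have e2 := sub_ne_zero.2 (hbK y h3)
            rw [hχ1 y hy, Complex.ofReal_one, one_mul, Complex.exp_neg, hℓe y h3]
            field_simp
        exact ContinuousAt.congr (by fun_prop) h2.symm
      · have h1 : ∀ᶠ y in 𝓝 z, f y < 1 / 3 := by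
          have : f z < 1 / 3 := by rw [hf0 (Or.inl hzB)]; norm_num
          exact f.continuous.continuousAt.eventually (gt_mem_nhds this)
        have h2 : G =ᶠ[𝓝 z] fun y => y - a := by
          filter_upwards [h1] with y hy
          simp only [hG]
          split_ifs with h3 h4
          · rw [hf1 h4] at hy
            norm_num at hy
          · rfl
          · rw [hχ0 y hy]; simp
        exact ContinuousAt.congr (by fun_prop) h2.symm
    · have h2 : G =ᶠ[𝓝 z] fun y => (y - a) * Complex.exp (-(χ y * ℓ y)) := by
        filter_upwards [hKc.isOpen_compl.mem_nhds hz] with y hy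
        simp only [hG]
        rw [if_neg hy]
      have h3 : ContinuousAt ℓ z := hℓ.continuousAt (hKc.isOpen_compl.mem_nhds hz)
      exact ContinuousAt.congr (by fun_prop) h2.symm
  · intro z
    simp only [hG]
    split_ifs with h1 h2
    · exact sub_ne_zero.2 (hbA z h2)
    · exact sub_ne_zero.2 (haB z ((hK ▸ h1 : z ∈ A ∪ B).resolve_left h2))
    · exact mul_ne_zero (sub_ne_zero.2 (haK z h1)) (Complex.exp_ne_zero _)
  · intro z hz
    have hf0z := hf0 (Or.inr hz)
    simp only [hG]
    split_ifs with h1 h2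
    · exact absurd (mem_ball.1 (hR h2)) (not_lt.2 hz)
    · rfl
    · rw [hχ0 z (by rw [hf0z]; norm_num)]; simp

theorem backward (U : Set ℂ∞) (hUopen : IsOpen U)
    (hUsc : SimplyConnectedSpace U) (hinfty : ∞ ∈ U)
    (z₀ : ℂ) (hz₀ : (z₀ : ℂ∞) ∉ U)
    (H : ∀ δ > (0 : ℝ), ∃ ε > (0 : ℝ), ∀ w ∈ U,
        (w = ∞ ∨ ∀ x : ℂ, w = (x : ℂ∞) → δ ≤ dist x z₀) →
        ∃ γ : ℝ → ℂ∞, ContinuousOn γ (Icc 0 1) ∧ γ 0 = w ∧ γ 1 = ∞ ∧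
          MapsTo γ (Icc 0 1) (U \ ((fun c : ℂ => (c : ℂ∞)) '' closedBall z₀ ε))) :
    LocallyConnectedAt Uᶜ (z₀ : ℂ∞) := by
  classical
  intro V hV
  rw [nhdsWithin_coe, mem_map] at hV
  set K : Set ℂ := (fun c : ℂ => (c : ℂ∞)) ⁻¹' Uᶜ with hK
  have hKcl : IsClosed K := hUopen.isClosed_compl.preimage continuous_coe
  obtain ⟨r, hr, hrV⟩ := Metric.mem_nhdsWithin_iff.1 hV
  set δ := r / 2 with hδ
  have hδ0 : 0 < δ := half_pos hr
  obtain ⟨ε₁, hε₁, hε⟩ := H δ hδ0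
  set ε := min ε₁ δ with hεd
  have hε0 : 0 < ε := lt_min hε₁ hδ0
  set Kd := K ∩ closedBall z₀ δ with hKd
  have hKdc : IsCompact Kd := (isCompact_closedBall z₀ δ).inter_left hKcl
  have hz₀Kd : z₀ ∈ Kd := ⟨hz₀, mem_closedBall_self hδ0.le⟩
  -- main claim
  have main : K ∩ ball z₀ ε ⊆ connectedComponentIn Kd z₀ := by
    rintro x ⟨hxK, hxε⟩
    by_contra hxc
    have hxKd : x ∈ Kd := ⟨hxK, ball_subset_closedBall (ball_subset_ball (min_le_right _ _) hxε)⟩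
    have : CompactSpace Kd := isCompact_iff_compactSpace.1 hKdc
    rw [connectedComponentIn_eq_image hz₀Kd, connectedComponent_eq_iInter_isClopen] at hxc
    have : ∃ Z : Set Kd, IsClopen Z ∧ ⟨z₀, hz₀Kd⟩ ∈ Z ∧ ⟨x, hxKd⟩ ∉ Z := by
      by_contra hcon
      push Not at hcon
      exact hxc ⟨⟨x, hxKd⟩, mem_iInter.2 fun s => hcon s.1 s.2.1 s.2.2, rfl⟩
    obtain ⟨Z, hZ, hzZ, hxZ⟩ := this
    -- log on U
    have hxU : (x : ℂ∞) ∉ U := hxK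
    obtain ⟨l, hl, hle⟩ := Complex.exists_continuousOn_eqOn_exp_comp (U := U) hUsc hUopen
      (g := sphereRatio z₀ x)
      (fun p hp => (sphereRatio_continuousAt z₀ x p fun h => hxU (h ▸ hp)).continuousWithinAt)
      (by
        rintro ⟨p, hp, hp0⟩
        induction p using OnePoint.rec with
        | infty => simp [sphereRatio] at hp0
        | coe p =>
          change (p - z₀) / (p - x) = 0 at hp0
          rw [div_eq_zero_iff, sub_eq_zero, sub_eq_zero] at hp0
          rcases hp0 with rfl | rfl
          · exact hz₀ hp
          · exact hxU hp)
    have hle' : ∀ p ∈ U, Complex.exp (l p) = sphereRatio z₀ x p := fun p hp => hle hp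
    set c := l ∞ with hc
    have hce : Complex.exp c = 1 := by rw [hle' _ hinfty]; simp [sphereRatio]
    set L : ℂ∞ → ℂ := fun p => Complex.log (sphereRatio z₀ x p) + c with hL
    set D : Set ℂ∞ := (fun c : ℂ => (c : ℂ∞)) '' closedBall z₀ ε with hD
    have hxD : x ∈ closedBall z₀ ε :=
      ball_subset_closedBall hxε
    have hslit : ∀ p, p ∉ D → sphereRatio z₀ x p ∈ Complex.slitPlane :=
      sphereRatio_slit z₀ x _ (convex_closedBall z₀ ε) (mem_closedBall_self hε0.le) hxD
    have hLc : ∀ p, p ∉ D → ContinuousAt L p := fun p hp =>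
      ((sphereRatio_continuousAt z₀ x p fun h => hp ⟨x, hxD, h.symm⟩).clog (hslit p hp)).add
        continuousAt_const
    have hLe : ∀ p, p ∉ D → Complex.exp (L p) = sphereRatio z₀ x p := fun p hp => by
      simp only [hL]
      rw [Complex.exp_add, hce, mul_one, Complex.exp_log (Complex.slitPlane_ne_zero (hslit p hp))]
    have agree : ∀ w : ℂ, (w : ℂ∞) ∈ U → δ ≤ dist w z₀ → l w = L w := by
      intro w hw hwd
      obtain ⟨γ, hγ, h0, h1, hm⟩ := hε w hw (Or.inr fun y hy => by
        rw [OnePoint.coe_eq_coe] at hy; exact hy ▸ hwd)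
      have hm' : ∀ t ∈ Icc (0 : ℝ) 1, γ t ∉ D := fun t ht h =>
        (hm ht).2 (image_mono (closedBall_subset_closedBall (min_le_left _ _)) h)
      have := exp_lift_unique (s := Icc (0 : ℝ) 1) isPreconnected_Icc (g₁ := l ∘ γ) (g₂ := L ∘ γ)
        (hl.comp hγ fun t ht => (hm ht).1)
        (fun t ht => (hLc _ (hm' t ht)).comp_continuousWithinAt (hγ t ht))
        (fun t ht => by
          simp only [Function.comp]
          rw [hle' _ (hm ht).1, hLe _ (hm' t ht)]) (a := 1) (by simp)
        (by simp [h1, hL, sphereRatio, hc]) 0 (by simp)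
      simpa [h0] using this
    have hout : ∀ z : ℂ, δ < dist z z₀ → (z : ℂ∞) ∉ D := by
      rintro z hz ⟨y, hy, hyz⟩
      rw [OnePoint.coe_injective hyz, mem_closedBall] at hy
      exact absurd (hy.trans (min_le_right _ _)) (not_le.2 hz)
    have hfarK : ∀ z ∉ Kd, (z : ℂ∞) ∉ U → δ < dist z z₀ := fun z hz hzU => by
      by_contra hlt
      exact hz ⟨hzU, not_lt.1 hlt⟩
    refine split_contra Kd (Subtype.val '' Z) (Subtype.val '' Zᶜ)
      (hZ.isClosed.isCompact.image continuous_subtype_val)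
      (hZ.compl.isClosed.isCompact.image continuous_subtype_val)
      ((Set.disjoint_image_iff Subtype.val_injective).2 disjoint_compl_right)
      (by rw [← image_union, union_compl_self, image_univ, Subtype.range_coe]) z₀ x
      ⟨_, hzZ, rfl⟩ ⟨_, hxZ, rfl⟩
      (fun z => if (z : ℂ∞) ∈ U then l z else L z) ?_ ?_
    · intro z hz
      apply ContinuousAt.continuousWithinAt
      by_cases hzU : (z : ℂ∞) ∈ U
      · have h1 : ContinuousAt (fun y : ℂ => l y) z :=
          (hl.continuousAt (hUopen.mem_nhds hzU)).comp continuous_coe.continuousAt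
        refine h1.congr ?_
        filter_upwards [(hUopen.preimage continuous_coe).mem_nhds hzU] with y hy
        exact (if_pos (show (y : ℂ∞) ∈ U from hy)).symm
      · have hzd := hfarK z hz hzU
        have h1 : ContinuousAt (fun y : ℂ => L y) z :=
          (hLc _ (hout z hzd)).comp continuous_coe.continuousAt
        refine h1.congr ?_
        have h2 : IsOpen {y : ℂ | δ < dist y z₀} := isOpen_lt continuous_const (by fun_prop)
        filter_upwards [h2.mem_nhds hzd] with y hy
        split_ifs with hyU
        · exact (agree y hyU (le_of_lt hy)).symm
        · rfl
    · intro z hz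
      split_ifs with hzU
      · exact hle' _ hzU
      · exact hLe _ (hout z (hfarK z hz hzU))
  refine ⟨(fun c : ℂ => (c : ℂ∞)) '' connectedComponentIn Kd z₀, ?_, ?_, ?_⟩
  · rw [nhdsWithin_coe, mem_map]
    refine Filter.mem_of_superset (Metric.mem_nhdsWithin_iff.2 ⟨ε, hε0, Subset.rfl⟩) ?_
    rintro y ⟨hy, hyK⟩
    exact ⟨y, main ⟨hyK, hy⟩, rfl⟩
  · rintro _ ⟨y, hy, rfl⟩
    have hyK := connectedComponentIn_subset _ _ hy
    exact ⟨hyK.1, hrV ⟨closedBall_subset_ball (half_lt_self hr) hyK.2, hyK.1⟩⟩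
  · exact (isConnected_connectedComponentIn_iff.2 hz₀Kd).image _ continuous_coe.continuousOn

/-- Characterization of local connectivity of `K` at `z₀` in terms of curves to `∞`
avoiding small disks around `z₀`. -/
theorem stmt3
    (U : Set ℂ∞) (hUopen : IsOpen U) (hUconn : IsConnected U)
    (hUsc : SimplyConnectedSpace U) (hinfty : ∞ ∈ U)
    (hKconn : IsConnected Uᶜ) (hKnt : Set.Nontrivial Uᶜ)
    (z₀ : ℂ) (hz₀ : (z₀ : ℂ∞) ∈ frontier U) :
    LocallyConnectedAt Uᶜ (z₀ : ℂ∞) ↔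
      ∀ δ > (0 : ℝ), ∃ ε > (0 : ℝ), ∀ w ∈ U,
        (w = ∞ ∨ ∀ x : ℂ, w = (x : ℂ∞) → δ ≤ dist x z₀) →
        ∃ γ : ℝ → ℂ∞, ContinuousOn γ (Icc 0 1) ∧ γ 0 = w ∧ γ 1 = ∞ ∧
          MapsTo γ (Icc 0 1) (U \ ((fun c : ℂ => (c : ℂ∞)) '' closedBall z₀ ε)) := by
  have hz : (z₀ : ℂ∞) ∉ U := fun h => by
    rw [hUopen.frontier_eq] at hz₀
    exact hz₀.2 h
  exact ⟨fun hL δ hδ => forward U hUopen hUconn hinfty z₀ hz hL δ hδ,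
    fun H => backward U hUopen hUsc hinfty z₀ hz H⟩

end
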